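/- Let K and L carry recurrence structures with projection matrices B and C and sets of invariant measures P* and Q*, and let w : Δ(K)×Δ(L) → ℝ be continuous with w(p,q) = w(pB, qC) for all (p,q) (w is balanced). Then for all (p,q) ∈ Δ(K)×Δ(L): cav_I w(p,q) = sup{ Σ_m α_m w(p*_m, q) over all finite convex combinations with α_m ≥ 0, Σ_m α_m = 1, p*_m ∈ P*, and Σ_m α_m p*_m = pB }. In particular cav_I w is balanced: cav_I w(p,q) = cav_I w(p',q') whenever pB = p'B and qC = q'C. -/

import Mathlib

/-- The `L¹` distance between two vectors indexed by a finite set. -/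
noncomputable def dist1 {S : Type*} [Fintype S] (p p' : S → ℝ) : ℝ :=
  ∑ k, |p k - p' k|

/-- Row-vector times matrix multiplication, `(p A) k' = ∑ k, p k * A k k'`. -/
noncomputable def vecMulF {K : Type*} [Fintype K] (p : K → ℝ) (A : K → K → ℝ) : K → ℝ :=
  fun k' => ∑ k, p k * A k k'

/-- A recurrence structure on a finite set `K`: a partition of `K` into `R` nonempty
classes (given by the class map `cls`, surjectivity expressing nonemptiness of classes),
together with, for each class `r`, a probability vector `pstar r ∈ Δ(K)` supported
in the class `r`. -/
structure RecStruct (K : Type*) [Fintype K] (R : ℕ) where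
  cls : K → Fin R
  cls_surj : Function.Surjective cls
  pstar : Fin R → K → ℝ
  pstar_mem : ∀ r, pstar r ∈ stdSimplex ℝ K
  pstar_supp : ∀ r k, pstar r k ≠ 0 → cls k = r

namespace RecStruct

variable {K : Type*} [Fintype K] {R : ℕ}

/-- `lam rs p r` is the total mass given by `p` to the recurrence class `r`. -/
noncomputable def lam (rs : RecStruct K R) (p : K → ℝ) : Fin R → ℝ :=
  fun r => ∑ k, if rs.cls k = r then p k else 0

/-- The conditional law of `p` given the recurrence class `r` (equal to `pstar r` when the
class has zero mass under `p`). -/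
noncomputable def cond (rs : RecStruct K R) (p : K → ℝ) (r : Fin R) : K → ℝ :=
  if 0 < rs.lam p r then (fun k => if rs.cls k = r then p k / rs.lam p r else 0)
  else rs.pstar r

/-- The quantity `S(p,p') = ‖λ(p) - λ(p')‖₁ + ∑_{r : λ(p)^r λ(p')^r > 0} λ(p')^r ‖p_{|r} - p'_{|r}‖₁`. -/
noncomputable def Sdist (rs : RecStruct K R) (p p' : K → ℝ) : ℝ :=
  dist1 (rs.lam p) (rs.lam p') +
    ∑ r, if 0 < rs.lam p r * rs.lam p' r
      then rs.lam p' r * dist1 (rs.cond p r) (rs.cond p' r) else 0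

/-- The projection matrix `B`, whose row `k` is `pstar r` where `r` is the class of `k`. -/
noncomputable def Bmat (rs : RecStruct K R) : K → K → ℝ :=
  fun k k' => rs.pstar (rs.cls k) k'

/-- `P*`, the convex hull of the invariant measures of the classes. -/
noncomputable def Pset (rs : RecStruct K R) : Set (K → ℝ) :=
  convexHull ℝ (Set.range rs.pstar)

/-- `B^{-1}(p*) = {p ∈ Δ(K) : pB = p*}`. -/
def Binv (rs : RecStruct K R) (pst : K → ℝ) : Set (K → ℝ) :=
  {p | p ∈ stdSimplex ℝ K ∧ vecMulF p rs.Bmat = pst}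

/-- A stochastic matrix on `K` compatible with the recurrence structure: it is block
diagonal with respect to the partition and each `pstar r` is invariant. -/
structure IsCompatible (rs : RecStruct K R) (M : K → K → ℝ) : Prop where
  nonneg : ∀ k k', 0 ≤ M k k'
  rowSum : ∀ k, ∑ k', M k k' = 1
  block : ∀ k k', rs.cls k ≠ rs.cls k' → M k k' = 0
  invariant : ∀ r, vecMulF (rs.pstar r) M = rs.pstar r

end RecStruct

/-- `cavI f`, the concavification of `f` in its first variable over `Δ(K)`:
the supremum of `∑ α_m f(p_m, q)` over finite convex decompositions `p = ∑ α_m p_m`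
with `p_m ∈ Δ(K)`. -/
noncomputable def cavI {K L : Type*} [Fintype K] (f : (K → ℝ) → (L → ℝ) → ℝ)
    (p : K → ℝ) (q : L → ℝ) : ℝ :=
  sSup {x : ℝ | ∃ (n : ℕ) (α : Fin n → ℝ) (ps : Fin n → K → ℝ),
    (∀ m, 0 ≤ α m) ∧ (∑ m, α m = 1) ∧ (∀ m, ps m ∈ stdSimplex ℝ K) ∧
    (∑ m, α m • ps m = p) ∧ x = ∑ m, α m * f (ps m) q}

/-- `vexII f`, the convexification of `f` in its second variable over `Δ(L)`:
the infimum of `∑ α_m f(p, q_m)` over finite convex decompositions `q = ∑ α_m q_m`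
with `q_m ∈ Δ(L)`. -/
noncomputable def vexII {K L : Type*} [Fintype L] (f : (K → ℝ) → (L → ℝ) → ℝ)
    (p : K → ℝ) (q : L → ℝ) : ℝ :=
  sInf {x : ℝ | ∃ (n : ℕ) (α : Fin n → ℝ) (qs : Fin n → L → ℝ),
    (∀ m, 0 ≤ α m) ∧ (∑ m, α m = 1) ∧ (∀ m, qs m ∈ stdSimplex ℝ L) ∧
    (∑ m, α m • qs m = q) ∧ x = ∑ m, α m * f p (qs m)}

/-- Membership in `𝒞`: continuous on `Δ(K)×Δ(L)` with values in `[-1,1]` there. -/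
def MemC {K L : Type*} [Fintype K] [Fintype L] (f : (K → ℝ) → (L → ℝ) → ℝ) : Prop :=
  ContinuousOn (fun pq : (K → ℝ) × (L → ℝ) => f pq.1 pq.2)
    (stdSimplex ℝ K ×ˢ stdSimplex ℝ L) ∧
  ∀ p ∈ stdSimplex ℝ K, ∀ q ∈ stdSimplex ℝ L, f p q ∈ Set.Icc (-1 : ℝ) 1

/-- Membership in `𝒞⁺(f)`: `w ∈ 𝒞`, `w` is I-concave, and
`w(p,q) ≥ vex_II max(w,f)(p,q)` on `Δ(K)×Δ(L)`. -/
def memCplus {K L : Type*} [Fintype K] [Fintype L]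
    (f w : (K → ℝ) → (L → ℝ) → ℝ) : Prop :=
  MemC w ∧ (∀ q ∈ stdSimplex ℝ L, ConcaveOn ℝ (stdSimplex ℝ K) (fun p => w p q)) ∧
  ∀ p ∈ stdSimplex ℝ K, ∀ q ∈ stdSimplex ℝ L,
    vexII (fun p' q' => max (w p' q') (f p' q')) p q ≤ w p q

/-- Membership in `𝒞⁻(f)`: `w ∈ 𝒞`, `w` is II-convex, and
`w(p,q) ≤ cav_I min(w,f)(p,q)` on `Δ(K)×Δ(L)`. -/
def memCminus {K L : Type*} [Fintype K] [Fintype L]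
    (f w : (K → ℝ) → (L → ℝ) → ℝ) : Prop :=
  MemC w ∧ (∀ p ∈ stdSimplex ℝ K, ConvexOn ℝ (stdSimplex ℝ L) (fun q => w p q)) ∧
  ∀ p ∈ stdSimplex ℝ K, ∀ q ∈ stdSimplex ℝ L,
    w p q ≤ cavI (fun p' q' => min (w p' q') (f p' q')) p q

/-- A function `w` on `Δ(K)×Δ(L)` is balanced if `w(p,q) = w(pB, qC)`. -/
def BalancedFn {K L : Type*} [Fintype K] [Fintype L] {RK RL : ℕ}
    (rsK : RecStruct K RK) (rsL : RecStruct L RL)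
    (w : (K → ℝ) → (L → ℝ) → ℝ) : Prop :=
  ∀ p ∈ stdSimplex ℝ K, ∀ q ∈ stdSimplex ℝ L,
    w p q = w (vecMulF p rsK.Bmat) (vecMulF q rsL.Bmat)

namespace RecStruct

variable {K : Type*} [Fintype K] {R : ℕ}

theorem vecMulF_Bmat (rs : RecStruct K R) (p : K → ℝ) :
    vecMulF p rs.Bmat = ∑ r, rs.lam p r • rs.pstar r := by
  ext k'
  simp only [vecMulF, Bmat, lam, Finset.sum_apply, Pi.smul_apply, smul_eq_mul, Finset.sum_mul]
  rw [Finset.sum_comm]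
  simp [ite_mul]

theorem lam_nonneg (rs : RecStruct K R) {p : K → ℝ} (hp : p ∈ stdSimplex ℝ K) (r : Fin R) :
    0 ≤ rs.lam p r :=
  Finset.sum_nonneg fun k _ => by split_ifs <;> simp [hp.1 k]

theorem sum_lam (rs : RecStruct K R) {p : K → ℝ} (hp : p ∈ stdSimplex ℝ K) :
    ∑ r, rs.lam p r = 1 := by
  simp only [lam]
  rw [Finset.sum_comm, ← hp.2]
  simp

theorem lam_sum_smul (rs : RecStruct K R) {ι : Type*} [Fintype ι] (c : ι → ℝ) (v : ι → K → ℝ) :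
    rs.lam (∑ i, c i • v i) = ∑ i, c i • rs.lam (v i) := by
  ext r
  simp only [lam, Finset.sum_apply, Pi.smul_apply, smul_eq_mul, Finset.mul_sum, mul_ite, mul_zero]
  rw [Finset.sum_comm]
  refine Finset.sum_congr rfl fun k _ => ?_
  split_ifs <;> simp

theorem lam_eq_single (rs : RecStruct K R) {v : K → ℝ} (hv : v ∈ stdSimplex ℝ K) {r : Fin R}
    (hsupp : ∀ k, v k ≠ 0 → rs.cls k = r) : rs.lam v = Pi.single r 1 := by
  ext s
  by_cases h : s = r
  · subst h
    rw [Pi.single_eq_same, ← hv.2]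
    refine Finset.sum_congr rfl fun k _ => ?_
    split_ifs with hk
    · rfl
    · by_contra hne
      exact hk (hsupp k (Ne.symm hne))
  · rw [Pi.single_eq_of_ne h]
    refine Finset.sum_eq_zero fun k _ => ?_
    split_ifs with hk
    · by_contra hne
      exact h (hk.symm.trans (hsupp k hne))
    · rfl

theorem lam_mixture (rs : RecStruct K R) (c : Fin R → ℝ) {v : Fin R → K → ℝ}
    (hv : ∀ r, v r ∈ stdSimplex ℝ K) (hsupp : ∀ r k, v r k ≠ 0 → rs.cls k = r) :
    rs.lam (∑ r, c r • v r) = c := by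
  rw [lam_sum_smul]
  ext s
  simp [rs.lam_eq_single (hv _) (hsupp _), Pi.single_apply]

theorem lam_vecMulF_Bmat (rs : RecStruct K R) (p : K → ℝ) :
    rs.lam (vecMulF p rs.Bmat) = rs.lam p := by
  rw [vecMulF_Bmat, rs.lam_mixture _ rs.pstar_mem rs.pstar_supp]

theorem Pset_subset_stdSimplex (rs : RecStruct K R) : rs.Pset ⊆ stdSimplex ℝ K :=
  convexHull_min (Set.range_subset_iff.2 rs.pstar_mem) (convex_stdSimplex ℝ K)

theorem vecMulF_Bmat_mem_Pset (rs : RecStruct K R) {p : K → ℝ} (hp : p ∈ stdSimplex ℝ K) :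
    vecMulF p rs.Bmat ∈ rs.Pset := by
  rw [vecMulF_Bmat]
  exact (convex_convexHull ℝ _).sum_mem (fun r _ => rs.lam_nonneg hp r) (rs.sum_lam hp)
    fun r _ => subset_convexHull ℝ _ ⟨r, rfl⟩

theorem vecMulF_Bmat_sum_smul (rs : RecStruct K R) {ι : Type*} [Fintype ι] (c : ι → ℝ)
    (v : ι → K → ℝ) :
    vecMulF (∑ i, c i • v i) rs.Bmat = ∑ i, c i • vecMulF (v i) rs.Bmat := by
  simp only [vecMulF_Bmat, lam_sum_smul, Finset.sum_apply, Pi.smul_apply, Finset.sum_smul,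
    Finset.smul_sum, smul_assoc]
  exact Finset.sum_comm

theorem vecMulF_Bmat_of_mem_Pset (rs : RecStruct K R) {x : K → ℝ} (hx : x ∈ rs.Pset) :
    vecMulF x rs.Bmat = x := by
  refine convexHull_min (t := {x | vecMulF x rs.Bmat = x}) ?_ ?_ hx
  · rintro _ ⟨r, rfl⟩
    simp [vecMulF_Bmat, rs.lam_eq_single (rs.pstar_mem r) (rs.pstar_supp r), Pi.single_apply]
  · intro x hx y hy a b _ _ _
    have h := rs.vecMulF_Bmat_sum_smul ![a, b] ![x, y]
    simpa [hx.out, hy.out] using h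

theorem cond_mem (rs : RecStruct K R) {p : K → ℝ} (hp : p ∈ stdSimplex ℝ K) (r : Fin R) :
    rs.cond p r ∈ stdSimplex ℝ K := by
  unfold cond
  split_ifs with h
  · refine ⟨fun k => ?_, ?_⟩
    · dsimp only
      split_ifs
      · exact div_nonneg (hp.1 k) h.le
      · exact le_rfl
    · rw [← div_self h.ne']
      nth_rw 2 [lam]
      rw [Finset.sum_div]
      simp [ite_div]
  · exact rs.pstar_mem r

theorem cond_supp (rs : RecStruct K R) (p : K → ℝ) (r : Fin R) (k : K)
    (hk : rs.cond p r k ≠ 0) : rs.cls k = r := by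
  unfold cond at hk
  split_ifs at hk with h
  · by_contra hne
    simp [hne] at hk
  · exact rs.pstar_supp r k hk

theorem sum_lam_smul_cond (rs : RecStruct K R) {p : K → ℝ} (hp : p ∈ stdSimplex ℝ K) :
    ∑ r, rs.lam p r • rs.cond p r = p := by
  ext k
  rw [Finset.sum_apply, Finset.sum_eq_single (rs.cls k)]
  · by_cases h : 0 < rs.lam p (rs.cls k)
    · simp [cond, h, mul_div_cancel₀ _ h.ne']
    · have h0 : rs.lam p (rs.cls k) = 0 := le_antisymm (not_lt.1 h) (rs.lam_nonneg hp _)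
      have hk : p k = 0 := by
        have := (Finset.sum_eq_zero_iff_of_nonneg
          (fun j _ => by split_ifs <;> simp [hp.1 j])).1 h0 k (Finset.mem_univ k)
        simpa using this
      simp [h0, hk]
  · intro r _ hr
    by_contra hne
    exact hr (rs.cond_supp p r k fun h => hne (by simp [h])).symm
  · simp

/-- Every convex decomposition of `pB` into elements of `P*` lifts along `B` to a convex
decomposition of `p`. -/
theorem exists_lift_decomposition (rs : RecStruct K R) {p : K → ℝ} (hp : p ∈ stdSimplex ℝ K)
    {ι : Type*} [Fintype ι] {α : ι → ℝ} {x : ι → K → ℝ} (hx : ∀ i, x i ∈ rs.Pset)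
    (hsum : ∑ i, α i • x i = vecMulF p rs.Bmat) :
    ∃ y : ι → K → ℝ, (∀ i, y i ∈ stdSimplex ℝ K) ∧ (∀ i, vecMulF (y i) rs.Bmat = x i) ∧
      ∑ i, α i • y i = p := by
  refine ⟨fun i => ∑ r, rs.lam (x i) r • rs.cond p r, fun i => ?_, fun i => ?_, ?_⟩
  · have hi := rs.Pset_subset_stdSimplex (hx i)
    exact (convex_stdSimplex ℝ K).sum_mem (fun r _ => rs.lam_nonneg hi r) (rs.sum_lam hi)
      fun r _ => rs.cond_mem hp r
  · rw [vecMulF_Bmat, rs.lam_mixture _ (rs.cond_mem hp) (rs.cond_supp p), ← vecMulF_Bmat,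
      rs.vecMulF_Bmat_of_mem_Pset (hx i)]
  · conv_rhs => rw [← rs.sum_lam_smul_cond hp, ← rs.lam_vecMulF_Bmat p, ← hsum, lam_sum_smul]
    simp only [Finset.sum_apply, Pi.smul_apply, Finset.sum_smul, Finset.smul_sum, smul_assoc]
    exact Finset.sum_comm

end RecStruct

/-- For balanced `w`, the values of convex decompositions of `p` in `Δ(K)` are exactly the
values of convex decompositions of `pB` in `P*`. -/
theorem BalancedFn.cavI_eq {K L : Type*} [Fintype K] [Fintype L] {RK RL : ℕ}
    {rsK : RecStruct K RK} {rsL : RecStruct L RL} {w : (K → ℝ) → (L → ℝ) → ℝ}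
    (hbal : BalancedFn rsK rsL w) {p : K → ℝ} (hp : p ∈ stdSimplex ℝ K)
    {q : L → ℝ} (hq : q ∈ stdSimplex ℝ L) :
    cavI w p q = sSup {x : ℝ | ∃ (n : ℕ) (α : Fin n → ℝ) (ps : Fin n → K → ℝ),
      (∀ m, 0 ≤ α m) ∧ (∑ m, α m = 1) ∧ (∀ m, ps m ∈ rsK.Pset) ∧
      (∑ m, α m • ps m = vecMulF p rsK.Bmat) ∧ x = ∑ m, α m * w (ps m) q} := by
  have hproj : ∀ y ∈ stdSimplex ℝ K, w (vecMulF y rsK.Bmat) q = w y q := fun y hy => by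
    have hmem := rsK.vecMulF_Bmat_mem_Pset hy
    rw [hbal _ (rsK.Pset_subset_stdSimplex hmem) q hq, rsK.vecMulF_Bmat_of_mem_Pset hmem,
      ← hbal y hy q hq]
  unfold cavI
  congr 1
  ext x
  constructor
  · rintro ⟨n, α, ps, hα, hα1, hps, hsum, rfl⟩
    refine ⟨n, α, fun m => vecMulF (ps m) rsK.Bmat, hα, hα1,
      fun m => rsK.vecMulF_Bmat_mem_Pset (hps m), ?_, ?_⟩
    · rw [← hsum, rsK.vecMulF_Bmat_sum_smul]
    · simp only [hproj _ (hps _)]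
  · rintro ⟨n, α, ps, hα, hα1, hps, hsum, rfl⟩
    obtain ⟨y, hy, hyB, hysum⟩ := rsK.exists_lift_decomposition hp hps hsum
    refine ⟨n, α, y, hα, hα1, hy, hysum, ?_⟩
    simp only [← hyB, hproj _ (hy _)]

/-- **Concavification of balanced functions (step in Proposition `comparison`).**
For continuous balanced `w`, `cav_I w(p,q)` equals the supremum of `∑_m α_m w(p*_m, q)`
over convex decompositions of `pB` into points `p*_m ∈ P*`; in particular `cav_I w`
is balanced. -/
theorem cavI_of_balanced {K L : Type*} [Fintype K] [Fintype L] {RK RL : ℕ}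
    (rsK : RecStruct K RK) (rsL : RecStruct L RL)
    (w : (K → ℝ) → (L → ℝ) → ℝ)
    (hw : ContinuousOn (fun pq : (K → ℝ) × (L → ℝ) => w pq.1 pq.2)
      (stdSimplex ℝ K ×ˢ stdSimplex ℝ L))
    (hbal : BalancedFn rsK rsL w) :
    ∀ p ∈ stdSimplex ℝ K, ∀ q ∈ stdSimplex ℝ L,
      (cavI w p q = sSup {x : ℝ | ∃ (n : ℕ) (α : Fin n → ℝ) (ps : Fin n → K → ℝ),
          (∀ m, 0 ≤ α m) ∧ (∑ m, α m = 1) ∧ (∀ m, ps m ∈ rsK.Pset) ∧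
          (∑ m, α m • ps m = vecMulF p rsK.Bmat) ∧ x = ∑ m, α m * w (ps m) q}) ∧
      (∀ p' ∈ stdSimplex ℝ K, ∀ q' ∈ stdSimplex ℝ L,
        vecMulF p rsK.Bmat = vecMulF p' rsK.Bmat →
        vecMulF q rsL.Bmat = vecMulF q' rsL.Bmat →
        cavI w p q = cavI w p' q') := by
  intro p hp q hq
  refine ⟨hbal.cavI_eq hp hq, fun p' hp' q' hq' hpp hqq => ?_⟩
  have hw' : ∀ x ∈ stdSimplex ℝ K, w x q = w x q' := fun x hx => by
    rw [hbal x hx q hq, hbal x hx q' hq', hqq]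
  rw [hbal.cavI_eq hp hq, hbal.cavI_eq hp' hq', hpp]
  congr 1
  ext x
  refine exists_congr fun n => exists_congr fun α => exists_congr fun ps =>
    and_congr_right fun _ => and_congr_right fun _ => and_congr_right fun hps =>
    and_congr_right fun _ => ?_
  simp only [hw' _ (rsK.Pset_subset_stdSimplex (hps _))]
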